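/- Under condition C1, K is a contrast function on Θ = [0, 1/2) × (ℝ² ∖ Δ), where Δ = {(x, x) : x ∈ ℝ}: K(θ) ≥ 0 for all θ ∈ Θ, and K(θ) = 0 if and only if λ = λ₀, μ₂ = μ₂⁰ and (when λ₀ > 0) μ₁ = μ₁⁰. In particular, if λ₀ ∈ (0, 1/2), then K(θ) = 0 if and only if θ = θ₀. -/

import Mathlib

open MeasureTheory

/-- The mixing operator `A_θ`. -/
noncomputable def Aop (lam mu₁ mu₂ : ℝ) (H : ℝ → ℝ) (x : ℝ) : ℝ :=
  lam * H (x - mu₁) + (1 - lam) * H (x - mu₂)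

/-- The inverse mixing operator `A_θ⁻¹`, defined by the geometric series. -/
noncomputable def Ainv (lam mu₁ mu₂ : ℝ) (H : ℝ → ℝ) (x : ℝ) : ℝ :=
  (1 / (1 - lam)) * ∑' k : ℕ, (-lam / (1 - lam)) ^ k * H (x + mu₂ + (k : ℝ) * (mu₂ - mu₁))

/-- The symmetry operator `S_r`. -/
noncomputable def Sr (H : ℝ → ℝ) (x : ℝ) : ℝ := 1 - H (-x)

theorem charFun_sum_smul {ι : Type*} [Fintype ι] (w : ι → NNReal) (μ : ι → Measure ℝ)
    [∀ i, IsFiniteMeasure (μ i)] (t : ℝ) :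
    charFun (∑ i, w i • μ i) t = ∑ i, (w i : ℂ) * charFun (μ i) t := by
  simp only [charFun_eq_integral_innerProbChar]
  rw [integral_finsetSum_measure
    fun i _ => BoundedContinuousFunction.integrable (w i • μ i) _]
  simp [integral_smul_nnreal_measure, NNReal.smul_def]

theorem analyticOnNhd_sum_exp {ι : Type*} [Fintype ι] (w d : ι → ℝ) :
    AnalyticOnNhd ℝ (fun t : ℝ => ∑ i, (w i : ℂ) * Complex.exp (t * d i * Complex.I))
      Set.univ := by
  intro t _
  have h : AnalyticAt ℝ (fun t : ℝ => (t : ℂ)) t := Complex.ofRealCLM.analyticAt t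
  refine Finset.analyticAt_fun_sum _ fun i _ => analyticAt_const.mul ?_
  have h2 : AnalyticAt ℝ Complex.exp (t * d i * Complex.I) :=
    analyticAt_cexp.restrictScalars
  exact h2.comp_of_eq ((h.mul analyticAt_const).mul analyticAt_const) rfl

theorem sum_shift_symm {ι : Type*} [Fintype ι] (ν : Measure ℝ) [IsProbabilityMeasure ν]
    (w d : ι → ℝ) (hw : ∀ i, 0 ≤ w i)
    (h : ∀ x, ∑ i, w i * (ν (Set.Iic (x - d i))).toReal =
      ∑ i, w i * (ν (Set.Iic (x + d i))).toReal) (y : ℝ) :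
    ∑ i, (if d i = y then w i else 0) = ∑ i, (if d i = -y then w i else 0) := by
  have hpush (e : ι → ℝ) (i : ι) : IsFiniteMeasure (ν.map (· + e i)) := inferInstance
  have hchar (e : ι → ℝ) (t : ℝ) : charFun (∑ i, (w i).toNNReal • ν.map (· + e i)) t =
      charFun ν t * ∑ i, w i * Complex.exp (t * e i * Complex.I) := by
    rw [charFun_sum_smul, Finset.mul_sum]
    refine Finset.sum_congr rfl fun i _ => ?_
    rw [charFun_map_add_const, Real.coe_toNNReal _ (hw i)]
    simp
    ring
  have hdir (e : ι → ℝ) (t : ℝ) : charFun (∑ i, (w i).toNNReal • Measure.dirac (e i)) t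
      = ∑ i, w i * Complex.exp (t * e i * Complex.I) := by
    rw [charFun_sum_smul]
    refine Finset.sum_congr rfl fun i _ => ?_
    rw [charFun_dirac, Real.coe_toNNReal _ (hw i)]
    simp
  have hmass (e : ι → ℝ) (x : ℝ) : (∑ i, (w i).toNNReal • ν.map (· + e i)).real (Set.Iic x) =
      ∑ i, w i * (ν (Set.Iic (x - e i))).toReal := by
    rw [measureReal_def, Measure.finsetSum_apply, ENNReal.toReal_sum (by finiteness)]
    refine Finset.sum_congr rfl fun i _ => ?_
    rw [Measure.smul_apply, Measure.map_apply (by fun_prop) measurableSet_Iic]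
    have : (fun x => x + e i) ⁻¹' Set.Iic x = Set.Iic (x - e i) := by
      ext z; simp [le_sub_iff_add_le]
    rw [this]
    simp [ENNReal.smul_def, hw i]
  have hE : (∑ i, (w i).toNNReal • ν.map (· + d i)) =
      ∑ i, (w i).toNNReal • ν.map (· + (-d) i) := by
    refine Measure.ext_of_Iic _ _ fun x => ?_
    rw [← measureReal_eq_measureReal_iff, hmass, hmass, h]
    simp
  have hne : ∀ᶠ t in nhds (0 : ℝ), charFun ν t ≠ 0 :=
    (continuous_charFun.continuousAt (x := (0 : ℝ))).eventually_ne (by simp)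
  have hfun := (analyticOnNhd_sum_exp w d).eq_of_eventuallyEq (analyticOnNhd_sum_exp w (-d))
    (z₀ := 0) (by
      filter_upwards [hne] with t ht
      refine mul_left_cancel₀ ht ?_
      rw [← hchar, ← hchar, hE])
  have hq : (∑ i, (w i).toNNReal • Measure.dirac (d i)) =
      ∑ i, (w i).toNNReal • Measure.dirac ((-d) i) := by
    refine Measure.ext_of_charFun (funext fun t => ?_)
    rw [hdir, hdir]
    exact congrFun hfun t
  have hatom (e : ι → ℝ) : (∑ i, (w i).toNNReal • Measure.dirac (e i)).real {y} =
      ∑ i, (if e i = y then w i else 0) := by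
    rw [measureReal_def, Measure.finsetSum_apply, ENNReal.toReal_sum (by finiteness)]
    refine Finset.sum_congr rfl fun i _ => ?_
    rw [Measure.smul_apply, Measure.dirac_apply' _ (measurableSet_singleton y)]
    by_cases hy : e i = y <;> simp [hy, ENNReal.smul_def, hw i]
  rw [← hatom d, hq, hatom]
  simp [neg_eq_iff_eq_neg]

theorem extremes_eq_of_symm {a b c d wa wb wc wd : ℝ}
    (hwa : 0 < wa) (hwd : 0 < wd) (hab : a < b) (hac : a < c) (hbd : b < d) (hcd : c < d)
    (h : ∀ y : ℝ, (if a = y then wa else 0) + (if b = y then wb else 0) +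
        (if c = y then wc else 0) + (if d = y then wd else 0) =
      (if a = -y then wa else 0) + (if b = -y then wb else 0) +
        (if c = -y then wc else 0) + (if d = -y then wd else 0)) :
    a + d = 0 ∧ wa = wd := by
  have h1 := h a
  have h4 := h d
  rcases lt_trichotomy (a + d) 0 with hs | hs | hs
  · exfalso
    rw [if_pos rfl, if_neg (by linarith), if_neg (by linarith), if_neg (by linarith),
      if_neg (by linarith), if_neg (by linarith), if_neg (by linarith), if_neg (by linarith)] at h1
    linarith
  · refine ⟨hs, ?_⟩
    rw [if_pos rfl, if_neg (by linarith), if_neg (by linarith), if_neg (by linarith),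
      if_neg (by linarith), if_neg (by linarith), if_neg (by linarith), if_pos (by linarith)] at h1
    linarith
  · exfalso
    rw [if_neg (by linarith), if_neg (by linarith), if_neg (by linarith), if_pos rfl,
      if_neg (by linarith), if_neg (by linarith), if_neg (by linarith), if_neg (by linarith)] at h4
    linarith

theorem param_eq {lam mu₁ mu₂ lam₀ mu₁₀ mu₂₀ : ℝ}
    (hlam : lam ∈ Set.Ico (0 : ℝ) (1 / 2)) (hmu : mu₁ ≠ mu₂)
    (hlam₀ : lam₀ ∈ Set.Ico (0 : ℝ) (1 / 2)) (hmu₀ : mu₁₀ ≠ mu₂₀)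
    (h : ∀ y : ℝ, (if mu₁₀ - mu₁ = y then lam₀ * lam else 0) +
        (if mu₁₀ - mu₂ = y then lam₀ * (1 - lam) else 0) +
        (if mu₂₀ - mu₁ = y then (1 - lam₀) * lam else 0) +
        (if mu₂₀ - mu₂ = y then (1 - lam₀) * (1 - lam) else 0) =
      (if mu₁₀ - mu₁ = -y then lam₀ * lam else 0) +
        (if mu₁₀ - mu₂ = -y then lam₀ * (1 - lam) else 0) +
        (if mu₂₀ - mu₁ = -y then (1 - lam₀) * lam else 0) +
        (if mu₂₀ - mu₂ = -y then (1 - lam₀) * (1 - lam) else 0)) :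
    lam = lam₀ ∧ mu₂ = mu₂₀ ∧ (0 < lam₀ → mu₁ = mu₁₀) := by
  obtain ⟨hq, hq'⟩ := hlam
  obtain ⟨hp, hp'⟩ := hlam₀
  rcases hp.eq_or_lt with rfl | hp
  · have h3 := h (mu₂₀ - mu₁)
    have h4 := h (mu₂₀ - mu₂)
    simp only [zero_mul, sub_zero, one_mul, ite_self, zero_add, sub_right_inj, if_true, hmu,
      hmu.symm, if_false, add_zero] at h3 h4
    have h4' : mu₂₀ - mu₂ = 0 := by grind
    grind
  rcases hq.eq_or_lt with rfl | hq
  · have h3 := h (mu₁₀ - mu₂)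
    have h4 := h (mu₂₀ - mu₂)
    simp only [mul_zero, sub_zero, mul_one, ite_self, zero_add, sub_left_inj, if_true, hmu₀,
      hmu₀.symm, if_false, add_zero] at h3 h4
    have h4' : mu₂₀ - mu₂ = 0 := by grind
    grind
  have hw1 : 0 < lam₀ * lam := by positivity
  have hw2 : 0 < lam₀ * (1 - lam) := mul_pos hp (by linarith)
  have hw3 : 0 < (1 - lam₀) * lam := mul_pos (by linarith) hq
  have hw4 : 0 < (1 - lam₀) * (1 - lam) := mul_pos (by linarith) (by linarith)
  have hw14 : lam₀ * lam < (1 - lam₀) * (1 - lam) := by nlinarith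
  have inner (hs : mu₁₀ - mu₂ + (mu₂₀ - mu₁) = 0) (he : lam₀ * (1 - lam) = (1 - lam₀) * lam) :
      lam = lam₀ ∧ mu₂ = mu₂₀ ∧ (0 < lam₀ → mu₁ = mu₁₀) := by
    have h4 := h (mu₂₀ - mu₂)
    simp only [sub_left_inj, sub_right_inj, hmu, hmu₀, if_false, if_true] at h4
    have h4' : mu₂₀ - mu₂ = 0 := by
      by_contra hne
      rw [if_neg (by intro; apply hne; linarith), if_pos (by linarith),
        if_neg (by intro; apply hmu; linarith), if_neg (by intro; apply hmu₀; linarith),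
        if_neg (by intro; apply hne; linarith)] at h4
      linarith
    exact ⟨by linarith, by linarith, fun _ => by linarith⟩
  rcases hmu.lt_or_gt with hm | hm <;> rcases hmu₀.lt_or_gt with hm₀ | hm₀
  · obtain ⟨hs, he⟩ := extremes_eq_of_symm (a := mu₁₀ - mu₂) (b := mu₁₀ - mu₁) (c := mu₂₀ - mu₂)
      (d := mu₂₀ - mu₁) hw2 hw3 (by linarith) (by linarith) (by linarith) (by linarith)
      (wb := lam₀ * lam) (wc := (1 - lam₀) * (1 - lam)) fun y => by linarith [h y]
    exact inner hs he
  · obtain ⟨-, he⟩ := extremes_eq_of_symm (a := mu₂₀ - mu₂) (b := mu₁₀ - mu₂) (c := mu₂₀ - mu₁)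
      (d := mu₁₀ - mu₁) hw4 hw1 (by linarith) (by linarith) (by linarith) (by linarith)
      (wb := lam₀ * (1 - lam)) (wc := (1 - lam₀) * lam) fun y => by linarith [h y]
    linarith
  · obtain ⟨-, he⟩ := extremes_eq_of_symm (a := mu₁₀ - mu₁) (b := mu₁₀ - mu₂) (c := mu₂₀ - mu₁)
      (d := mu₂₀ - mu₂) hw1 hw4 (by linarith) (by linarith) (by linarith) (by linarith)
      (wb := lam₀ * (1 - lam)) (wc := (1 - lam₀) * lam) fun y => by linarith [h y]
    linarith
  · obtain ⟨hs, he⟩ := extremes_eq_of_symm (a := mu₂₀ - mu₁) (b := mu₁₀ - mu₁) (c := mu₂₀ - mu₂)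
      (d := mu₁₀ - mu₂) hw3 hw2 (by linarith) (by linarith) (by linarith) (by linarith)
      (wb := lam₀ * lam) (wc := (1 - lam₀) * (1 - lam)) fun y => by linarith [h y]
    exact inner (by linarith) he.symm

theorem abs_neg_div_one_sub_lt_one {lam : ℝ} (hlam : lam ∈ Set.Ico (0 : ℝ) (1 / 2)) :
    |-lam / (1 - lam)| < 1 := by
  obtain ⟨h0, h1⟩ := hlam
  rw [abs_div, abs_neg, abs_of_nonneg h0, abs_of_pos (by linarith), div_lt_one (by linarith)]
  linarith

theorem norm_pow_mul_le {r C : ℝ} {H : ℝ → ℝ} (hH : ∀ x, |H x| ≤ C) (k : ℕ) (x : ℝ) :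
    ‖r ^ k * H x‖ ≤ |r| ^ k * C := by
  rw [Real.norm_eq_abs, abs_mul, abs_pow]
  exact mul_le_mul_of_nonneg_left (hH x) (by positivity)

theorem summable_abs_pow_mul {lam : ℝ} (hlam : lam ∈ Set.Ico (0 : ℝ) (1 / 2)) (C : ℝ) :
    Summable fun k : ℕ => |-lam / (1 - lam)| ^ k * C :=
  (summable_geometric_of_lt_one (abs_nonneg _) (abs_neg_div_one_sub_lt_one hlam)).mul_right C

theorem summable_pow_mul {lam : ℝ} (hlam : lam ∈ Set.Ico (0 : ℝ) (1 / 2)) {H : ℝ → ℝ} {C : ℝ}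
    (hH : ∀ x, |H x| ≤ C) (f : ℕ → ℝ) :
    Summable fun k : ℕ => (-lam / (1 - lam)) ^ k * H (f k) :=
  (summable_abs_pow_mul hlam C).of_norm_bounded fun k => norm_pow_mul_le hH k (f k)

theorem exists_abs_Ainv_le {lam mu₁ mu₂ : ℝ} (hlam : lam ∈ Set.Ico (0 : ℝ) (1 / 2))
    {H : ℝ → ℝ} {C : ℝ} (hH : ∀ x, |H x| ≤ C) : ∃ D, ∀ x, |Ainv lam mu₁ mu₂ H x| ≤ D := by
  refine ⟨|1 / (1 - lam)| * ∑' k : ℕ, |-lam / (1 - lam)| ^ k * C, fun x => ?_⟩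
  rw [Ainv, abs_mul]
  refine mul_le_mul_of_nonneg_left ?_ (abs_nonneg _)
  exact tsum_of_norm_bounded (summable_abs_pow_mul hlam C).hasSum
    fun k => norm_pow_mul_le hH k _

theorem continuous_Ainv {lam mu₁ mu₂ : ℝ} (hlam : lam ∈ Set.Ico (0 : ℝ) (1 / 2))
    {H : ℝ → ℝ} {C : ℝ} (hH : ∀ x, |H x| ≤ C) (hc : Continuous H) :
    Continuous (Ainv lam mu₁ mu₂ H) :=
  continuous_const.mul <| continuous_tsum (fun k => by fun_prop) (summable_abs_pow_mul hlam C)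
    fun k x => norm_pow_mul_le hH k _

theorem Ainv_Aop {lam mu₁ mu₂ : ℝ} (hlam : lam ∈ Set.Ico (0 : ℝ) (1 / 2))
    {H : ℝ → ℝ} {C : ℝ} (hH : ∀ x, |H x| ≤ C) : Ainv lam mu₁ mu₂ (Aop lam mu₁ mu₂ H) = H := by
  funext x
  have hne : 1 - lam ≠ 0 := by have := hlam.2; linarith
  have hs := summable_pow_mul hlam hH fun k : ℕ => x + k * (mu₂ - mu₁)
  have key (k : ℕ) : (-lam / (1 - lam)) ^ k *
      Aop lam mu₁ mu₂ H (x + mu₂ + (k : ℝ) * (mu₂ - mu₁)) =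
      (1 - lam) * ((-lam / (1 - lam)) ^ k * H (x + k * (mu₂ - mu₁)) -
        (-lam / (1 - lam)) ^ (k + 1) * H (x + (k + 1 : ℕ) * (mu₂ - mu₁))) := by
    have e1 : x + mu₂ + (k : ℝ) * (mu₂ - mu₁) - mu₁ = x + (k + 1 : ℕ) * (mu₂ - mu₁) := by
      push_cast; ring
    have e2 : x + mu₂ + (k : ℝ) * (mu₂ - mu₁) - mu₂ = x + k * (mu₂ - mu₁) := by ring
    rw [Aop, e1, e2, pow_succ]
    field_simp
    ring
  rw [Ainv, tsum_congr key, tsum_mul_left, hs.tsum_sub ((summable_nat_add_iff 1).2 hs),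
    hs.tsum_eq_zero_add, ← mul_assoc, one_div_mul_cancel hne]
  simp

theorem Aop_Ainv {lam mu₁ mu₂ : ℝ} (hlam : lam ∈ Set.Ico (0 : ℝ) (1 / 2))
    {H : ℝ → ℝ} {C : ℝ} (hH : ∀ x, |H x| ≤ C) : Aop lam mu₁ mu₂ (Ainv lam mu₁ mu₂ H) = H := by
  funext x
  have hne : 1 - lam ≠ 0 := by have := hlam.2; linarith
  have hs := summable_pow_mul hlam hH fun k : ℕ => x + k * (mu₂ - mu₁)
  have e1 (k : ℕ) : x - mu₁ + mu₂ + (k : ℝ) * (mu₂ - mu₁) = x + (k + 1 : ℕ) * (mu₂ - mu₁) := by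
    push_cast; ring
  have e2 (k : ℕ) : x - mu₂ + mu₂ + (k : ℝ) * (mu₂ - mu₁) = x + k * (mu₂ - mu₁) := by ring
  simp only [Aop, Ainv, e1, e2]
  rw [hs.tsum_eq_zero_add]
  simp only [pow_succ', mul_assoc, tsum_mul_left]
  generalize ∑' k : ℕ, (-lam / (1 - lam)) ^ k * H (x + ((k + 1 : ℕ) : ℝ) * (mu₂ - mu₁)) = S
  field_simp
  simp

theorem abs_Aop_le {lam : ℝ} (hlam : lam ∈ Set.Ico (0 : ℝ) (1 / 2)) (mu₁ mu₂ : ℝ)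
    {H : ℝ → ℝ} {C : ℝ} (hH : ∀ x, |H x| ≤ C) (x : ℝ) : |Aop lam mu₁ mu₂ H x| ≤ C := by
  obtain ⟨h0, h1⟩ := hlam
  have a := abs_le.1 (hH (x - mu₁))
  have b := abs_le.1 (hH (x - mu₂))
  rw [Aop, abs_le]
  constructor <;> nlinarith

theorem abs_Sr_le {H : ℝ → ℝ} {C : ℝ} (hH : ∀ x, |H x| ≤ C) (x : ℝ) : |Sr H x| ≤ 1 + C := by
  have := abs_le.1 (hH (-x))
  rw [Sr, abs_le]
  constructor <;> linarith

theorem continuous_Aop (lam mu₁ mu₂ : ℝ) {H : ℝ → ℝ} (hc : Continuous H) :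
    Continuous (Aop lam mu₁ mu₂ H) := by
  unfold Aop; fun_prop

theorem continuous_Sr {H : ℝ → ℝ} (hc : Continuous H) : Continuous (Sr H) := by
  unfold Sr; fun_prop

/-- If `H` and `F` are fixed by `Sr` and have the same mixture under two parameters, then the
four-point combination of translates of `F` is invariant under reversing the translations. -/
theorem four_point_symm {lam mu₁ mu₂ lam₀ mu₁₀ mu₂₀ : ℝ} {H F : ℝ → ℝ}
    (hH : Sr H = H) (hF : Sr F = F) (h : Aop lam mu₁ mu₂ H = Aop lam₀ mu₁₀ mu₂₀ F) (x : ℝ) :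
    lam₀ * lam * F (x - (mu₁₀ - mu₁)) + lam₀ * (1 - lam) * F (x - (mu₁₀ - mu₂)) +
        (1 - lam₀) * lam * F (x - (mu₂₀ - mu₁)) +
        (1 - lam₀) * (1 - lam) * F (x - (mu₂₀ - mu₂)) =
      lam₀ * lam * F (x + (mu₁₀ - mu₁)) + lam₀ * (1 - lam) * F (x + (mu₁₀ - mu₂)) +
        (1 - lam₀) * lam * F (x + (mu₂₀ - mu₁)) +
        (1 - lam₀) * (1 - lam) * F (x + (mu₂₀ - mu₂)) := by
  have symm {L : ℝ → ℝ} (hL : Sr L = L) (y z : ℝ) (hyz : y = -z) : L y = 1 - L z := by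
    rw [hyz, ← congrFun hL]; simp [Sr]
  have e (y : ℝ) : lam * H (y - mu₁) + (1 - lam) * H (y - mu₂) =
      lam₀ * F (y - mu₁₀) + (1 - lam₀) * F (y - mu₂₀) := congrFun h y
  have e1 := e (x + mu₁)
  have e2 := e (x + mu₂)
  have e3 := e (-x + mu₁)
  have e4 := e (-x + mu₂)
  rw [symm hF (-x + mu₁ - mu₁₀) (x + (mu₁₀ - mu₁)) (by ring),
    symm hF (-x + mu₁ - mu₂₀) (x + (mu₂₀ - mu₁)) (by ring),
    symm hH (-x + mu₁ - mu₂) (x + mu₂ - mu₁) (by ring),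
    symm hH (-x + mu₁ - mu₁) (x + mu₁ - mu₁) (by ring)] at e3
  rw [symm hF (-x + mu₂ - mu₁₀) (x + (mu₁₀ - mu₂)) (by ring),
    symm hF (-x + mu₂ - mu₂₀) (x + (mu₂₀ - mu₂)) (by ring),
    symm hH (-x + mu₂ - mu₁) (x + mu₁ - mu₂) (by ring),
    symm hH (-x + mu₂ - mu₂) (x + mu₂ - mu₂) (by ring)] at e4
  simp only [sub_sub_eq_add_sub]
  have hx1 : x + mu₁ - mu₁ = x + mu₂ - mu₂ := by ring
  rw [hx1] at e1 e3
  linear_combination (-lam) * e1 - (1 - lam) * e2 - lam * e3 - (1 - lam) * e4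

theorem isOpenPosMeasure_of_strictMono {ν : Measure ℝ}
    (h : StrictMono fun x => (ν (Set.Iic x)).toReal) : ν.IsOpenPosMeasure := by
  refine ⟨fun U hU ⟨x, hx⟩ h0 => ?_⟩
  obtain ⟨u, hu, hsub⟩ := exists_Ioc_subset_of_mem_nhds (hU.mem_nhds hx) ⟨x - 1, by linarith⟩
  have hle : ν (Set.Iic x) ≤ ν (Set.Iic u) := by
    rw [← Set.Iic_union_Ioc_eq_Iic hu.le]
    refine (measure_union_le _ _).trans ?_
    rw [measure_mono_null hsub h0, add_zero]
  have hge : ν (Set.Iic u) ≤ ν (Set.Iic x) := measure_mono (Set.Iic_subset_Iic.2 hu.le)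
  exact (h hu).ne (congrArg ENNReal.toReal (hge.antisymm hle))

/-- A symmetric probability measure with a continuous distribution function is fixed by `Sr`. -/
theorem Sr_cdf_eq {ν : Measure ℝ} [IsProbabilityMeasure ν] (hsym : ν.map (fun x => -x) = ν)
    {F : ℝ → ℝ} (hF : ∀ x, F x = (ν (Set.Iic x)).toReal) (hc : Continuous F) : Sr F = F := by
  have hlt (x : ℝ) : 1 - F (-x) = ν.real (Set.Iio x) := by
    have h1 : ν.real (Set.Iio x) = ν.real (Set.Ioi (-x)) := by
      conv_lhs => rw [← hsym]
      rw [measureReal_def, Measure.map_apply measurable_neg measurableSet_Iio, ← measureReal_def]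
      congr 1
      ext z
      simp
    rw [h1, ← Set.compl_Iic, probReal_compl_eq_one_sub measurableSet_Iic, hF, measureReal_def]
  have hF' (x : ℝ) : F x = ν.real (Set.Iic x) := hF x
  funext x
  refine le_antisymm ?_ ?_
  · rw [Sr, hlt, hF']
    exact measureReal_mono Set.Iio_subset_Iic_self
  · have hcS : Continuous (Sr F) := continuous_Sr hc
    refine le_of_tendsto_of_tendsto (hc.tendsto x |>.mono_left nhdsWithin_le_nhds)
      (tendsto_const_nhds (x := Sr F x) (f := nhdsWithin x (Set.Iio x))) ?_
    filter_upwards [self_mem_nhdsWithin] with y hy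
    rw [Sr, hlt, hF']
    exact measureReal_mono (Set.Iic_subset_Iio.2 hy)

/-- Under C1, `K` is a contrast function on `Θ = [0, 1/2) × (ℝ² ∖ Δ)`. -/
theorem stmt_13
    (ν : Measure ℝ) (hprob : IsProbabilityMeasure ν) (hsym : ν.map (fun x => -x) = ν)
    (F₀ : ℝ → ℝ) (hF₀ : ∀ x : ℝ, F₀ x = (ν (Set.Iic x)).toReal)
    -- condition C1
    (hmono : StrictMono F₀) (hlip : ∃ L : NNReal, LipschitzWith L F₀)
    (lam₀ mu₁₀ mu₂₀ : ℝ) (hlam₀ : lam₀ ∈ Set.Ico (0 : ℝ) (1 / 2)) (hmu₀ : mu₁₀ ≠ mu₂₀)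
    (G : ℝ → ℝ) (hG : ∀ x : ℝ, G x = lam₀ * F₀ (x - mu₁₀) + (1 - lam₀) * F₀ (x - mu₂₀))
    -- the Lebesgue–Stieltjes measure of G is the mixture measure
    (P : Measure ℝ)
    (hP : P = ENNReal.ofReal lam₀ • ν.map (fun x => x + mu₁₀)
        + ENNReal.ofReal (1 - lam₀) • ν.map (fun x => x + mu₂₀))
    (K : ℝ × ℝ × ℝ → ℝ)
    (hK : ∀ θ : ℝ × ℝ × ℝ, K θ = ∫ x : ℝ,
      (Aop θ.1 θ.2.1 θ.2.2 (Sr (Ainv θ.1 θ.2.1 θ.2.2 G)) x - G x) ^ 2 ∂P) :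
    (∀ θ : ℝ × ℝ × ℝ, θ.1 ∈ Set.Ico (0 : ℝ) (1 / 2) → θ.2.1 ≠ θ.2.2 →
      0 ≤ K θ ∧
      (K θ = 0 ↔ θ.1 = lam₀ ∧ θ.2.2 = mu₂₀ ∧ (0 < lam₀ → θ.2.1 = mu₁₀))) ∧
    (lam₀ ∈ Set.Ioo (0 : ℝ) (1 / 2) →
      ∀ θ : ℝ × ℝ × ℝ, θ.1 ∈ Set.Ico (0 : ℝ) (1 / 2) → θ.2.1 ≠ θ.2.2 →
        (K θ = 0 ↔ θ = (lam₀, mu₁₀, mu₂₀))) := by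
  obtain ⟨L, hL⟩ := hlip
  have hc : Continuous F₀ := hL.continuous
  have hFS : Sr F₀ = F₀ := Sr_cdf_eq hsym hF₀ hc
  have hFb (x : ℝ) : |F₀ x| ≤ 1 := by
    rw [hF₀, abs_of_nonneg ENNReal.toReal_nonneg]
    exact measureReal_le_one
  have hGA : G = Aop lam₀ mu₁₀ mu₂₀ F₀ := funext hG
  have hGb (x : ℝ) : |G x| ≤ 1 := hGA ▸ abs_Aop_le hlam₀ mu₁₀ mu₂₀ hFb x
  have hGc : Continuous G := hGA ▸ continuous_Aop lam₀ mu₁₀ mu₂₀ hc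
  have hPfin : IsFiniteMeasure P := by
    have h₁ := Measure.smul_finite (ν.map (fun x => x + mu₁₀)) (ENNReal.ofReal_ne_top (r := lam₀))
    have h₂ := Measure.smul_finite (ν.map (fun x => x + mu₂₀))
      (ENNReal.ofReal_ne_top (r := 1 - lam₀))
    rw [hP]
    infer_instance
  have hPpos : P.IsOpenPosMeasure := by
    have hν : ν.IsOpenPosMeasure := isOpenPosMeasure_of_strictMono (by simpa only [← hF₀])
    have hmap : (ν.map (fun x => x + mu₂₀)).IsOpenPosMeasure :=
      Continuous.isOpenPosMeasure_map (by fun_prop) (add_right_surjective mu₂₀)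
    have hsmul := Measure.isOpenPosMeasure_smul (ν.map (fun x => x + mu₂₀))
      (c := ENNReal.ofReal (1 - lam₀)) (by simpa using hlam₀.2.trans (by norm_num))
    rw [hP]
    exact (Measure.le_add_left le_rfl).isOpenPosMeasure
  have main (θ : ℝ × ℝ × ℝ) (hθ : θ.1 ∈ Set.Ico (0 : ℝ) (1 / 2)) (hθ' : θ.2.1 ≠ θ.2.2) :
      K θ = 0 ↔ θ.1 = lam₀ ∧ θ.2.2 = mu₂₀ ∧ (0 < lam₀ → θ.2.1 = mu₁₀) := by
    obtain ⟨lam, mu₁, mu₂⟩ := θ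
    dsimp only at hθ hθ' ⊢
    obtain ⟨D, hD⟩ := exists_abs_Ainv_le (mu₁ := mu₁) (mu₂ := mu₂) hθ hGb
    rw [hK]
    dsimp only
    set H := Ainv lam mu₁ mu₂ G with hH
    have hAH : Aop lam mu₁ mu₂ H = G := Aop_Ainv hθ hGb
    have hdc : Continuous fun x => (Aop lam mu₁ mu₂ (Sr H) x - G x) ^ 2 :=
      ((continuous_Aop _ _ _ (continuous_Sr (continuous_Ainv hθ hGb hGc))).sub hGc).pow 2
    have hint : Integrable (fun x => (Aop lam mu₁ mu₂ (Sr H) x - G x) ^ 2) P := by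
      refine Integrable.of_bound hdc.aestronglyMeasurable ((1 + D + 1) ^ 2) (.of_forall fun x => ?_)
      rw [norm_pow, Real.norm_eq_abs]
      exact pow_le_pow_left₀ (abs_nonneg _) ((abs_sub _ _).trans
        (add_le_add (abs_Aop_le hθ mu₁ mu₂ (abs_Sr_le hD) x) (hGb x))) 2
    have hzero : ∫ x, (Aop lam mu₁ mu₂ (Sr H) x - G x) ^ 2 ∂P = 0 ↔
        Aop lam mu₁ mu₂ (Sr H) = G := by
      rw [integral_eq_zero_iff_of_nonneg (fun x => sq_nonneg _) hint,
        hdc.ae_eq_iff_eq P continuous_zero]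
      simp [funext_iff, sub_eq_zero]
    rw [hzero]
    constructor
    · intro hA
      have hHS : Sr H = H := by
        rw [← Ainv_Aop (mu₁ := mu₁) (mu₂ := mu₂) hθ (abs_Sr_le hD), hA]
      refine param_eq hθ hθ' hlam₀ hmu₀ fun y => ?_
      have hl₀ : 0 ≤ 1 - lam₀ := by linarith [hlam₀.2]
      have hl : 0 ≤ 1 - lam := by linarith [hθ.2]
      have := sum_shift_symm ν
        ![lam₀ * lam, lam₀ * (1 - lam), (1 - lam₀) * lam, (1 - lam₀) * (1 - lam)]
        ![mu₁₀ - mu₁, mu₁₀ - mu₂, mu₂₀ - mu₁, mu₂₀ - mu₂]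
        (by
          intro i
          fin_cases i
          exacts [mul_nonneg hlam₀.1 hθ.1, mul_nonneg hlam₀.1 hl, mul_nonneg hl₀ hθ.1,
            mul_nonneg hl₀ hl])
        (fun x => by
          simp only [← hF₀, Fin.sum_univ_four]
          exact four_point_symm hHS hFS (hAH.trans hGA) x) y
      simp only [Fin.sum_univ_four] at this
      exact this
    · rintro ⟨rfl, rfl, h1⟩
      have hop : Aop lam mu₁₀ mu₂ F₀ = Aop lam mu₁ mu₂ F₀ := by
        rcases hθ.1.eq_or_lt with h0 | h0
        · subst h0
          funext x
          simp [Aop]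
        · rw [h1 h0]
      rw [hH, hGA, hop, Ainv_Aop hθ hFb, hFS]
  refine ⟨fun θ hθ hθ' => ⟨?_, main θ hθ hθ'⟩, fun hl θ hθ hθ' => ?_⟩
  · rw [hK]
    exact integral_nonneg fun x => sq_nonneg _
  · rw [main θ hθ hθ', Prod.ext_iff, Prod.ext_iff]
    have := hl.1
    tauto
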